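/- Equality case of monotone ascent: suppose θ₀ satisfies θ₀(u) > 0 for all u and Σ_u θ₀(u) = 1, and wins(u) > 0 and c_{θ₀}(u) > 0 for every u ∈ A ⊕ B. Let θ̃(u) = wins(u) / c_{θ₀}(u) and θ₁ = θ̃ / Σ_u θ̃(u). Then L(θ₁) = L(θ₀) if and only if θ₁ = θ₀. -/

import Mathlib

open Real

variable {A B : Type*}

/-- Bipartite Bradley–Terry log-likelihood: `w a b` counts wins of supporter `a` over
attacker `b`, `l a b` counts wins of `b` over `a`, and `θ` assigns positive strengths to
elements of `A ⊕ B`. -/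
noncomputable def btLogLik [Fintype A] [Fintype B]
    (θ : A ⊕ B → ℝ) (w l : A → B → ℝ) : ℝ :=
  (∑ a : A, ∑ b : B, (w a b * Real.log (θ (Sum.inl a)) + l a b * Real.log (θ (Sum.inr b))))
    - ∑ a : A, ∑ b : B, (w a b + l a b) * Real.log (θ (Sum.inl a) + θ (Sum.inr b))

/-- Total wins of each element: `wins(a) = Σ_b w a b` for a supporter `a`, and
`wins(b) = Σ_a l a b` for an attacker `b`. -/
noncomputable def btWins [Fintype A] [Fintype B] (w l : A → B → ℝ) : A ⊕ B → ℝ :=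
  Sum.elim (fun a => ∑ b : B, w a b) (fun b => ∑ a : A, l a b)

/-- MM denominator: `c_θ(u) = Σ n_{uv} / (θ u + θ v)` over cross-pairs containing `u`,
where `n a b = w a b + l a b`. -/
noncomputable def btDenom [Fintype A] [Fintype B]
    (w l : A → B → ℝ) (θ : A ⊕ B → ℝ) : A ⊕ B → ℝ :=
  Sum.elim
    (fun a => ∑ b : B, (w a b + l a b) / (θ (Sum.inl a) + θ (Sum.inr b)))
    (fun b => ∑ a : A, (w a b + l a b) / (θ (Sum.inl a) + θ (Sum.inr b)))

/-- MM minorizing surrogate `Q(θ | θ₀)`. -/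
noncomputable def btSurrogate [Fintype A] [Fintype B]
    (w l : A → B → ℝ) (θ θ₀ : A ⊕ B → ℝ) : ℝ :=
  (∑ u : A ⊕ B, btWins w l u * Real.log (θ u)) - ∑ u : A ⊕ B, θ u * btDenom w l θ₀ u

/-- The log-likelihood is invariant under rescaling all strengths by a nonzero constant. -/
lemma btLogLik_const_mul [Fintype A] [Fintype B] (w l : A → B → ℝ) {θ : A ⊕ B → ℝ}
    (hθ : ∀ u, 0 < θ u) {c : ℝ} (hc : c ≠ 0) :
    btLogLik (fun u => c * θ u) w l = btLogLik θ w l := by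
  simp only [btLogLik, ← Finset.sum_sub_distrib]
  refine Finset.sum_congr rfl fun a _ => Finset.sum_congr rfl fun b _ => ?_
  have ha := hθ (Sum.inl a)
  have hb := hθ (Sum.inr b)
  rw [← mul_add, Real.log_mul hc ha.ne', Real.log_mul hc hb.ne',
    Real.log_mul hc (add_pos ha hb).ne']
  ring

/-- The total-wins weighted sum, regrouped over the pairs of a supporter and an attacker. -/
lemma sum_btWins_mul [Fintype A] [Fintype B] (w l : A → B → ℝ) (f : A ⊕ B → ℝ) :
    ∑ u, btWins w l u * f u =
      ∑ a, ∑ b, (w a b * f (Sum.inl a) + l a b * f (Sum.inr b)) := by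
  simp only [Fintype.sum_sum_type, btWins, Sum.elim_inl, Sum.elim_inr, Finset.sum_mul,
    Finset.sum_add_distrib]
  rw [Finset.sum_comm (f := fun b a => l a b * f (Sum.inr b))]

/-- The linear term of the surrogate, regrouped over the pairs of a supporter and an attacker. -/
lemma sum_mul_btDenom [Fintype A] [Fintype B] (w l : A → B → ℝ) (θ θ₀ : A ⊕ B → ℝ) :
    ∑ u, θ u * btDenom w l θ₀ u =
      ∑ a, ∑ b, (w a b + l a b) *
        ((θ (Sum.inl a) + θ (Sum.inr b)) / (θ₀ (Sum.inl a) + θ₀ (Sum.inr b))) := by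
  simp only [Fintype.sum_sum_type, btDenom, Sum.elim_inl, Sum.elim_inr, Finset.mul_sum]
  rw [Finset.sum_comm (s := (Finset.univ : Finset B))]
  simp only [← Finset.sum_add_distrib]
  refine Finset.sum_congr rfl fun a _ => Finset.sum_congr rfl fun b _ => ?_
  ring

/-- The surrogate minorizes the log-likelihood: its increase from `θ₀` to `θ` is at most
the increase of the log-likelihood. -/
lemma btSurrogate_sub_le_btLogLik_sub [Fintype A] [Fintype B] {w l : A → B → ℝ}
    (hw : ∀ a b, 0 ≤ w a b) (hl : ∀ a b, 0 ≤ l a b) {θ θ₀ : A ⊕ B → ℝ}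
    (hθ : ∀ u, 0 < θ u) (hθ₀ : ∀ u, 0 < θ₀ u) :
    btSurrogate w l θ θ₀ - btSurrogate w l θ₀ θ₀ ≤ btLogLik θ w l - btLogLik θ₀ w l := by
  simp only [btSurrogate, btLogLik, sum_mul_btDenom,
    sum_btWins_mul w l fun u => Real.log (θ u), sum_btWins_mul w l fun u => Real.log (θ₀ u),
    ← Finset.sum_sub_distrib]
  refine Finset.sum_le_sum fun a _ => Finset.sum_le_sum fun b _ => ?_
  have hs := add_pos (hθ (Sum.inl a)) (hθ (Sum.inr b))
  have hs₀ := add_pos (hθ₀ (Sum.inl a)) (hθ₀ (Sum.inr b))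
  have hlog := Real.log_le_sub_one_of_pos (div_pos hs hs₀)
  rw [Real.log_div hs.ne' hs₀.ne'] at hlog
  rw [div_self hs₀.ne']
  linarith [mul_le_mul_of_nonneg_left hlog (add_nonneg (hw a b) (hl a b))]

/-- The function `x ↦ p * log x - x * c` has `p / c` as its unique maximizer on the
positive reals. -/
lemma mul_log_sub_mul_lt {p c x : ℝ} (hp : 0 < p) (hc : 0 < c) (hx : 0 < x) (hne : x ≠ p / c) :
    p * Real.log x - x * c < p * Real.log (p / c) - p / c * c := by
  have hpc := div_pos hp hc
  have hlog := Real.log_lt_sub_one_of_pos (div_pos hx hpc) (by rwa [Ne, div_eq_one_iff_eq hpc.ne'])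
  rw [Real.log_div hx.ne' hpc.ne'] at hlog
  have hmul := mul_lt_mul_of_pos_left hlog hp
  have hxc : p * (x / (p / c) - 1) = x * c - p / c * c := by field_simp
  linarith

/-- The MM update strictly increases the surrogate unless it is stationary. -/
lemma btSurrogate_lt_of_ne [Fintype A] [Fintype B] {w l : A → B → ℝ} {θ θ₀ : A ⊕ B → ℝ}
    (hθ : ∀ u, 0 < θ u) (hwins : ∀ u, 0 < btWins w l u) (hden : ∀ u, 0 < btDenom w l θ₀ u)
    (hne : θ ≠ fun u => btWins w l u / btDenom w l θ₀ u) :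
    btSurrogate w l θ θ₀ <
      btSurrogate w l (fun u => btWins w l u / btDenom w l θ₀ u) θ₀ := by
  obtain ⟨v, hv⟩ := Function.ne_iff.mp hne
  simp only [btSurrogate, ← Finset.sum_sub_distrib]
  refine Finset.sum_lt_sum (fun u _ => ?_)
    ⟨v, Finset.mem_univ v, mul_log_sub_mul_lt (hwins v) (hden v) (hθ v) hv⟩
  by_cases hu : θ u = btWins w l u / btDenom w l θ₀ u
  · rw [hu]
  · exact (mul_log_sub_mul_lt (hwins u) (hden u) (hθ u) hu).le

/-- Equality case of monotone ascent: if moreover `Σ_u θ₀(u) = 1`, then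
`L(θ₁) = L(θ₀)` iff `θ₁ = θ₀`. -/
theorem btMM_ascent_equality [Fintype A] [Fintype B]
    (w l : A → B → ℝ) (hw : ∀ a b, 0 ≤ w a b) (hl : ∀ a b, 0 ≤ l a b)
    (θ₀ : A ⊕ B → ℝ) (hθ₀ : ∀ u, 0 < θ₀ u) (hsum : ∑ u : A ⊕ B, θ₀ u = 1)
    (hwins : ∀ u, 0 < btWins w l u) (hden : ∀ u, 0 < btDenom w l θ₀ u)
    (θtilde θ₁ : A ⊕ B → ℝ)
    (hθtilde : θtilde = fun u => btWins w l u / btDenom w l θ₀ u)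
    (hθ₁ : θ₁ = fun u => θtilde u / ∑ v : A ⊕ B, θtilde v) :
    btLogLik θ₁ w l = btLogLik θ₀ w l ↔ θ₁ = θ₀ := by
  refine ⟨fun hL => ?_, fun h => by rw [h]⟩
  have hpos : ∀ u, 0 < θtilde u := fun u => by
    rw [hθtilde]
    exact div_pos (hwins u) (hden u)
  have hne : (Finset.univ : Finset (A ⊕ B)).Nonempty :=
    Finset.nonempty_of_sum_ne_zero (hsum.trans_ne one_ne_zero)
  have hS : 0 < ∑ v, θtilde v := Finset.sum_pos (fun u _ => hpos u) hne
  have hscale : btLogLik θ₁ w l = btLogLik θtilde w l := by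
    rw [hθ₁, ← btLogLik_const_mul w l hpos (inv_ne_zero hS.ne')]
    simp only [div_eq_inv_mul]
  have hfix : θ₀ = θtilde := by
    by_contra hθ
    have hlt := btSurrogate_lt_of_ne hθ₀ hwins hden (hθtilde ▸ hθ)
    rw [← hθtilde] at hlt
    linarith [btSurrogate_sub_le_btLogLik_sub hw hl hpos hθ₀]
  rw [hθ₁, ← hfix, hsum]
  simp only [div_one]
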